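/- arXiv:2310.11104 — 2 statements merged into one kernel-verified Lean document; each statement's English description precedes it below -/
import Mathlib

section
/- The inclusion Π_ZF ⊆ Π* holds; that is, for every M ∈ DHD^n, the matrix Π = diag(0, Π̂) with Π̂ = Kᵀ [[0, M], [Mᵀ, 0]] K and K = [[I_n, −I_n], [0, I_n]] satisfies (1, q, Φ(q))ᵀ Π (1, q, Φ(q)) ≥ 0 for all q ∈ ℝ^n. -/
open Matrix

/-- The entrywise ReLU. -/
def reluVec {k : Type*} (q : k → ℝ) : k → ℝ := fun i => max (q i) 0

/-- The vector `(1, q, p) ∈ ℝ^{2n+1}`. -/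
def aug {n : ℕ} (q p : Fin n → ℝ) : Unit ⊕ Fin n ⊕ Fin n → ℝ :=
  Sum.elim (fun _ => 1) (Sum.elim q p)

/-- The multiplier class `Π⋆ ⊂ S^{2n+1}`. -/
def PiStar (n : ℕ) : Set (Matrix (Unit ⊕ Fin n ⊕ Fin n) (Unit ⊕ Fin n ⊕ Fin n) ℝ) :=
  {P | ∀ q p : Fin n → ℝ, p = reluVec q → 0 ≤ aug q p ⬝ᵥ P *ᵥ aug q p}

/-- `M ∈ DHD^n`: doubly hyperdominant matrices. -/
def DHD {n : ℕ} (M : Matrix (Fin n) (Fin n) ℝ) : Prop :=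
  (∀ i j, i ≠ j → M i j ≤ 0) ∧ (∀ i, 0 ≤ ∑ j, M i j) ∧ (∀ j, 0 ≤ ∑ i, M i j)

/-- The matrix `K = [[Iₙ, −Iₙ],[0, Iₙ]]`. -/
noncomputable def Kmat (n : ℕ) : Matrix (Fin n ⊕ Fin n) (Fin n ⊕ Fin n) ℝ :=
  Matrix.fromBlocks (1 : Matrix (Fin n) (Fin n) ℝ) (-(1 : Matrix (Fin n) (Fin n) ℝ))
    0 (1 : Matrix (Fin n) (Fin n) ℝ)

/-- The O'Shea-Zames-Falb multiplier class
`Π_ZF := {diag(0, Kᵀ [[0,M],[Mᵀ,0]] K) : M ∈ DHD^n}`. -/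
noncomputable def PiZF (n : ℕ) :
    Set (Matrix (Unit ⊕ Fin n ⊕ Fin n) (Unit ⊕ Fin n ⊕ Fin n) ℝ) :=
  {P | ∃ M : Matrix (Fin n) (Fin n) ℝ, DHD M ∧
    P = Matrix.fromBlocks (0 : Matrix Unit Unit ℝ) 0 0
      ((Kmat n)ᵀ * Matrix.fromBlocks 0 M Mᵀ 0 * Kmat n)}

lemma Kmat_mulVec_elim {n : ℕ} (q p : Fin n → ℝ) :
    Kmat n *ᵥ Sum.elim q p = Sum.elim (q - p) p := by
  simp [Kmat, fromBlocks_mulVec, sub_eq_add_neg, neg_mulVec]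

/-- The quadratic form of a Zames-Falb multiplier is twice the bilinear form of `M`. -/
lemma aug_dotProduct_zamesFalb_mulVec {n : ℕ} (M : Matrix (Fin n) (Fin n) ℝ) (q p : Fin n → ℝ) :
    aug q p ⬝ᵥ fromBlocks (0 : Matrix Unit Unit ℝ) 0 0
      ((Kmat n)ᵀ * fromBlocks 0 M Mᵀ 0 * Kmat n) *ᵥ aug q p = 2 * ((q - p) ⬝ᵥ M *ᵥ p) := by
  have h : p ⬝ᵥ Mᵀ *ᵥ (q - p) = (q - p) ⬝ᵥ M *ᵥ p := by
    rw [mulVec_transpose, dotProduct_comm, dotProduct_mulVec]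
  rw [aug, fromBlocks_mulVec, sumElim_dotProduct_sumElim]
  simp only [Sum.elim_comp_inl, Sum.elim_comp_inr, zero_mulVec, add_zero, zero_add,
    dotProduct_zero]
  rw [← mulVec_mulVec, ← mulVec_mulVec, Kmat_mulVec_elim, dotProduct_mulVec, vecMul_transpose,
    Kmat_mulVec_elim, fromBlocks_mulVec, sumElim_dotProduct_sumElim]
  simp only [Sum.elim_comp_inl, Sum.elim_comp_inr, zero_mulVec, add_zero, zero_add]
  rw [h, two_mul]

/-- The bilinear form of a matrix with nonpositive off-diagonal entries is nonnegative on the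
negative and positive parts of a vector. -/
lemma sub_reluVec_dotProduct_mulVec_nonneg {k : Type*} [Fintype k] {M : Matrix k k ℝ}
    (hM : ∀ i j, i ≠ j → M i j ≤ 0) (q : k → ℝ) :
    0 ≤ (q - reluVec q) ⬝ᵥ M *ᵥ reluVec q := by
  simp only [dotProduct, mulVec, Finset.mul_sum, Pi.sub_apply, reluVec]
  refine Finset.sum_nonneg fun i _ => Finset.sum_nonneg fun j _ => ?_
  have hi : q i - max (q i) 0 ≤ 0 := sub_nonpos.2 (le_max_left _ _)
  by_cases hij : i = j
  · subst hij
    rcases le_total (q i) 0 with h | h <;> simp [h]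
  · exact mul_nonneg_of_nonpos_of_nonpos hi
      (mul_nonpos_of_nonpos_of_nonneg (hM i j hij) (le_max_right _ _))

/-- `Π_ZF ⊆ Π⋆`. -/
theorem PiZF_subset_PiStar (n : ℕ) : PiZF n ⊆ PiStar n := by
  rintro _ ⟨M, hM, rfl⟩ q _ rfl
  rw [aug_dotProduct_zamesFalb_mulVec]
  exact mul_nonneg zero_le_two (sub_reluVec_dotProduct_mulVec_nonneg hM.1 q)
end

section
/- The inclusion Π_ZF ⊆ Π_NN holds; that is, for every M ∈ DHD^n there exist J ∈ D^n and Q ∈ NN^{2n+1} such that diag(0, Kᵀ [[0, M], [Mᵀ, 0]] K) = Eᵀ(Q + J(J))E, where K = [[I_n, −I_n], [0, I_n]]. -/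
open Matrix

/-- The nonnegative cone `NN^k`: symmetric entrywise-nonnegative matrices. -/
def NNcone (k : Type*) [Fintype k] : Set (Matrix k k ℝ) :=
  {Q | Q.IsSymm ∧ ∀ i j, 0 ≤ Q i j}

/-- The matrix `E = [[1,0,0],[0,−Iₙ,Iₙ],[0,0,Iₙ]]`. -/
noncomputable def Emat (n : ℕ) :
    Matrix (Unit ⊕ Fin n ⊕ Fin n) (Unit ⊕ Fin n ⊕ Fin n) ℝ :=
  Matrix.fromBlocks (1 : Matrix Unit Unit ℝ) 0 0
    (Matrix.fromBlocks (-(1 : Matrix (Fin n) (Fin n) ℝ)) (1 : Matrix (Fin n) (Fin n) ℝ)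
      0 (1 : Matrix (Fin n) (Fin n) ℝ))

/-- The matrix `J(J) = [[0,0,0],[0,0,J],[0,Jᵀ,0]]` for `J ∈ D^n`. -/
def calJ {n : ℕ} (J : Matrix (Fin n) (Fin n) ℝ) :
    Matrix (Unit ⊕ Fin n ⊕ Fin n) (Unit ⊕ Fin n ⊕ Fin n) ℝ :=
  Matrix.fromBlocks 0 0 0 (Matrix.fromBlocks 0 J Jᵀ 0)

/-- `Π_ZF ⊆ Π_NN`: for every `M ∈ DHD^n` there exist a diagonal `J` and
`Q ∈ NN^{2n+1}` with `diag(0, Kᵀ [[0,M],[Mᵀ,0]] K) = Eᵀ(Q + J(J))E`. -/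
theorem PiZF_subset_PiNN {n : ℕ} (M : Matrix (Fin n) (Fin n) ℝ) (hM : DHD M) :
    ∃ (J : Matrix (Fin n) (Fin n) ℝ)
      (Q : Matrix (Unit ⊕ Fin n ⊕ Fin n) (Unit ⊕ Fin n ⊕ Fin n) ℝ),
      J.IsDiag ∧ Q ∈ NNcone _ ∧
      Matrix.fromBlocks (0 : Matrix Unit Unit ℝ) 0 0
          ((Kmat n)ᵀ * Matrix.fromBlocks 0 M Mᵀ 0 * Kmat n) =
        (Emat n)ᵀ * (Q + calJ J) * Emat n := by
  refine ⟨-diagonal M.diag,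
    fromBlocks 0 0 0 (fromBlocks 0 (diagonal M.diag - M) (diagonal M.diag - M)ᵀ 0),
    (isDiag_diagonal _).neg, ⟨?_, ?_⟩, ?_⟩
  · simp [IsSymm, fromBlocks_transpose]
  · have hoff : ∀ i j, 0 ≤ (diagonal M.diag - M) i j := by
      intro i j
      by_cases h : i = j
      · subst h
        simp
      · simpa [h] using hM.1 i j h
    rintro (i | i | i) (j | j | j)
    all_goals first
      | exact le_rfl
      | exact hoff i j
      | exact hoff j i
  · have hD : (diagonal M.diag)ᵀ = diagonal M.diag := diagonal_transpose _
    generalize diagonal M.diag = D at hD ⊢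
    simp [Emat, calJ, fromBlocks_transpose, fromBlocks_multiply, fromBlocks_add, Kmat, hD]
    abel
end
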